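/- Let κ > 0 and let ABC be a triangle in the hyperbolic plane of curvature −κ² with side lengths x = AB, y = AC, z = BC, all positive, and angles α = ∠BAC, β = ∠ABC. Then sinh(κz) = [(cosh(κy)+cosh(κz))/(1+cosh(κx))]·sinh(κx)·cos β − sinh(κy)·cos(α+β). -/

import Mathlib

open Real

/-- Hyperbolic identity: for a non-degenerate triangle in the hyperbolic plane of
curvature `−κ²` with sides `x = AB`, `y = AC`, `z = BC` and angles `α = ∠BAC`, `β = ∠ABC`
(encoded by the hyperbolic laws of cosines at `A` and `B` and the hyperbolic law of sines),
`sinh(κz) = [(cosh(κy)+cosh(κz))/(1+cosh(κx))]·sinh(κx)·cos β − sinh(κy)·cos(α+β)`. -/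
theorem hyperbolic_growth_identity (κ x y z α β : ℝ) (hκ : 0 < κ)
    (hx : 0 < x) (hy : 0 < y) (hz : 0 < z)
    (hα : α ∈ Set.Ioo (0 : ℝ) π) (hβ : β ∈ Set.Ioo (0 : ℝ) π)
    (hcosA : Real.cosh (κ * z)
      = Real.cosh (κ * x) * Real.cosh (κ * y)
        - Real.sinh (κ * x) * Real.sinh (κ * y) * Real.cos α)
    (hcosB : Real.cosh (κ * y)
      = Real.cosh (κ * x) * Real.cosh (κ * z)
        - Real.sinh (κ * x) * Real.sinh (κ * z) * Real.cos β)
    (hsine : Real.sinh (κ * z) * Real.sin β = Real.sinh (κ * y) * Real.sin α) :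
    Real.sinh (κ * z)
      = (Real.cosh (κ * y) + Real.cosh (κ * z)) / (1 + Real.cosh (κ * x))
          * Real.sinh (κ * x) * Real.cos β
        - Real.sinh (κ * y) * Real.cos (α + β) := by
  have hsx : Real.sinh (κ * x) ≠ 0 := (Real.sinh_pos_iff.2 (mul_pos hκ hx)).ne'
  have hcx : 1 + Real.cosh (κ * x) ≠ 0 := by positivity
  have hproj : (Real.cosh (κ * y) + Real.cosh (κ * z)) / (1 + Real.cosh (κ * x))
      * Real.sinh (κ * x)
      = Real.sinh (κ * y) * Real.cos α + Real.sinh (κ * z) * Real.cos β := by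
    rw [div_mul_eq_mul_div, div_eq_iff hcx]
    apply mul_left_cancel₀ hsx
    linear_combination (Real.cosh (κ * y) + Real.cosh (κ * z)) * Real.sinh_sq (κ * x)
      - (1 + Real.cosh (κ * x)) * (hcosA + hcosB)
  rw [hproj, Real.cos_add]
  linear_combination Real.sin β * hsine - Real.sinh (κ * z) * Real.sin_sq_add_cos_sq β
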